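/- There exists a finite semigroup S that is not a band (i.e., has a non-idempotent element), is self-dual, and is self-automaton. (Hence there is a finite non-band semigroup isomorphic to the dual Cayley automaton semigroup Π(C(S)), answering Cain's question negatively.) -/

import Mathlib

/-- The Cayley automaton state map: `cayley s` sends the word
`α₁α₂⋯αₙ` to `(sα₁)(sα₁α₂)⋯(sα₁α₂⋯αₙ)`. -/
def cayley {S : Type*} [Mul S] (s : S) : List S → List S
  | [] => []
  | a :: α => (s * a) :: cayley (s * a) α

/-- `S` is self-automaton if `s ↦ s̄` is injective and a homomorphism. -/
def SelfAutomaton (S : Type*) [Mul S] : Prop :=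
  Function.Injective (cayley (S := S)) ∧
    ∀ s t : S, cayley (s * t) = cayley s ∘ cayley t

/-- `S` is self-dual if it admits an anti-automorphism. -/
def SelfDual (S : Type*) [Mul S] : Prop :=
  ∃ φ : S ≃ S, ∀ x y : S, φ (x * y) = φ y * φ x

/-- `Σ(C(S))`: the subsemigroup of maps on words, under composition,
generated by the Cayley automaton state maps. -/
def SigmaC (S : Type*) [Mul S] : Subsemigroup (Function.End (List S)) :=
  Subsemigroup.closure (Set.range (cayley : S → Function.End (List S)))


/-! The semigroup used is generated by `a, x, y`, with `x, y` idempotent and all products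
idempotent. It has 24 elements, represented in order by the words
a, x, y, aa, ax, xy, ya, yx, aax, axy, xya, xyx, yaa, yax, yxy, axya, axyx, xyax, yaxy, yxya, axyax, yaxya, yaxyx, yxyax.
The products are reductive on both sides, and reversal with `x, y` swapped is an
anti-automorphism. -/

/-- Multiplication table, packed in base 32. -/
def mulCode : ℕ := 672104419792039071729299161334587893955910920661171750377459846236058066896863982203891561512968135946619202180207866207994819061062909803429669119094468433621668762802415786481287495025049609098157084249245075462167163551039170357405756498446844971257374125946155249442224745011354734153433291689877809128972999613726803344808851291999579129998465331609876021106667173712024690143613865207002417484049152502344848259669596042739760935942746283732901961383006356153407774104648202314819224152625548048859811828087285096496270313147759504871072576313224627537852337753583498249649647100862142126456684556194365883660026697787318154198817623508976452881912962579117210170654005536423984558648257395259293300714182470391832691773703853198245810057035810699206629941477827424303777072420786827432933557651271843982491469420495951183743151073233671514177721509217212401795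

/-- Anti-automorphism, packed in base 32. -/
def antiCode : ℕ := 944538526675627585596068551769293888

def tmul (i j : Fin 24) : Fin 24 :=
  ⟨(mulCode / 32 ^ (24 * i.val + j.val)) % 32 % 24, Nat.mod_lt _ (by decide)⟩

def tanti (i : Fin 24) : Fin 24 :=
  ⟨(antiCode / 32 ^ i.val) % 32 % 24, Nat.mod_lt _ (by decide)⟩

theorem tmul_assoc : ∀ i j k : Fin 24, tmul (tmul i j) k = tmul i (tmul j k) := by
  decide +kernel

theorem tmul_band : ∀ i j : Fin 24, tmul (tmul i j) (tmul i j) = tmul i j := by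
  decide +kernel

theorem tmul_faithful : ∀ i j : Fin 24, (∀ k, tmul i k = tmul j k) → i = j := by
  decide +kernel

theorem tanti_invol : ∀ i : Fin 24, tanti (tanti i) = i := by
  decide +kernel

theorem tanti_tmul : ∀ i j : Fin 24, tanti (tmul i j) = tmul (tanti j) (tanti i) := by
  decide +kernel

theorem cayley_absorb {S : Type*} [Semigroup S]
    (hb : ∀ x y : S, (x * y) * (x * y) = x * y) (α : List S) :
    ∀ p v : S, p * v = p → cayley p α = cayley p (cayley v α) := by
  induction α with
  | nil => intro p v _; rfl
  | cons a α ih =>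
    intro p v h
    have h1 : p * (v * a) = p * a := by rw [← mul_assoc, h]
    simp only [cayley]
    rw [h1, ← ih (p * a) (v * a)]
    rw [← h1, mul_assoc, hb]

theorem selfAutomaton_of_band {S : Type*} [Semigroup S]
    (hb : ∀ x y : S, (x * y) * (x * y) = x * y)
    (hf : ∀ s t : S, (∀ a, s * a = t * a) → s = t) : SelfAutomaton S := by
  refine ⟨fun s t h => hf s t fun a => ?_, fun s t => funext fun α => ?_⟩
  · have := congrFun h [a]
    simpa [cayley] using this
  · cases α with
    | nil => rfl
    | cons a α =>
      simp only [cayley, Function.comp]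
      rw [mul_assoc s t a, ← cayley_absorb hb α (s * (t * a)) (t * a)]
      rw [mul_assoc, hb]

theorem exists_nonband_selfDual_selfAutomaton :
    ∃ (S : Type) (inst : Semigroup S) (_ : Fintype S),
      (∃ a : S, inst.toMul.mul a a ≠ a) ∧
        @SelfDual S inst.toMul ∧ @SelfAutomaton S inst.toMul := by
  
  let inst : Semigroup (Fin 24) := { mul := tmul, mul_assoc := tmul_assoc }
  refine ⟨Fin 24, inst, inferInstance, ⟨0, ?_⟩, ?_, ?_⟩
  · change tmul 0 0 ≠ 0
    decide +kernel
  · exact ⟨⟨tanti, tanti, tanti_invol, tanti_invol⟩, tanti_tmul⟩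
  · exact @selfAutomaton_of_band (Fin 24) inst tmul_band tmul_faithful
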